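/- Let J ⊆ S be such that W_J is finite, and let α ∈ S∖J be a simple reflection such that the order m(α, β) of αβ is at least 3 for some β ∈ J (that is, α fails to commute with at least one element of J). Set w = w_{0,J}·α. Then ℓ(w) = ℓ(w_{0,J}) + 1 and the left descent set {s ∈ S : ℓ(sw) < ℓ(w)} of w is exactly J. -/

import Mathlib

/-!
Statement 9. Let `J ⊆ S` with `W_J` finite, and let `α ∈ S ∖ J` be a simple reflection such
that the order of `αβ` is at least 3 for some `β ∈ J` (that is, `α` fails to commute with at
least one element of `J`). Set `w = w_{0,J} * α`. Then `ℓ(w) = ℓ(w_{0,J}) + 1` and the left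
descent set of `w` is exactly `J`.
-/

variable {B W : Type*} [Group W] {M : CoxeterMatrix B}

/-- The standard parabolic subgroup `W_J`. -/
def CoxeterSystem.parabolic (cs : CoxeterSystem M W) (J : Set B) : Subgroup W :=
  Subgroup.closure (cs.simple '' J)

open Real Polynomial.Chebyshev in
theorem Module.reflection_mul_reflection_pow_eq_one_of_cos {V : Type*} [AddCommGroup V]
    [Module ℝ V] {x y : V} {f g : Module.Dual ℝ V} (hf : f x = 2) (hg : g y = 2) {m : ℕ}
    (hm : 2 ≤ m) (hfy : f y = -(2 * cos (π / m))) (hgx : g x = -(2 * cos (π / m))) :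
    (Module.reflection hf * Module.reflection hg) ^ m = 1 := by
  have hm0 : (m : ℝ) ≠ 0 := by positivity
  rcases hm.eq_or_lt with rfl | hm3
  · have hfy0 : f y = 0 := by simpa using hfy
    have hgx0 : g x = 0 := by simpa using hgx
    ext z
    simp only [pow_two, LinearEquiv.mul_apply, Module.reflection_apply, map_sub, map_smul, hf, hg,
      hfy0, hgx0]
    change _ = z
    module
  · set θ : ℝ := 2 * (π / m) with hθ
    have hmθ : m * θ = 2 * π := by rw [hθ]; field_simp
    have ht : 2 * cos θ = f y * g x - 2 := by
      rw [hfy, hgx, hθ, cos_two_mul]; ring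
    have hsin : sin θ ≠ 0 := by
      have h3 : (3 : ℝ) ≤ m := by exact_mod_cast hm3
      have hπ := pi_pos
      refine (sin_pos_of_pos_of_lt_pi (by positivity) ?_).ne'
      nlinarith
    ext z
    rw [Module.reflection_mul_reflection_pow_apply hf hg m z (2 * cos θ) ht]
    rcases Nat.even_or_odd' m with ⟨k, rfl | rfl⟩
    · have h1 : (((2 * k : ℕ) : ℤ) - 2) / 2 = k - 1 := by omega
      have h2 : (((2 * k : ℕ) : ℤ) - 1) / 2 = k - 1 := by omega
      have h0 : (S ℝ ((k : ℤ) - 1)).eval (2 * cos θ) = 0 := by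
        have h := S_two_mul_real_cos θ ((k : ℤ) - 1)
        have hkθ : ((((k : ℤ) - 1 : ℤ) : ℝ) + 1) * θ = π := by
          push_cast at hmθ ⊢; linarith
        rw [hkθ, sin_pi] at h
        exact (mul_eq_zero.mp h).resolve_right hsin
      rw [h1, h2, h0]
      simp
    · have h1 : (((2 * k + 1 : ℕ) : ℤ) - 2) / 2 = k - 1 := by omega
      have h2 : (((2 * k + 1 : ℕ) : ℤ) - 1) / 2 = k := by omega
      have h3 : (((2 * k + 1 : ℕ) : ℤ) - 3) / 2 = k - 1 := by omega
      have h4 : (((2 * k + 1 : ℕ) : ℤ)) / 2 = k := by omega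
      have h0 : (S ℝ (k : ℤ)).eval (2 * cos θ) + (S ℝ ((k : ℤ) - 1)).eval (2 * cos θ) = 0 := by
        have h := S_two_mul_real_cos θ (k : ℤ)
        have h' := S_two_mul_real_cos θ ((k : ℤ) - 1)
        have hkθ : (((k : ℤ) : ℝ) + 1) * θ = 2 * π - k * θ := by
          push_cast at hmθ ⊢; linarith
        have hkθ' : ((((k : ℤ) - 1 : ℤ) : ℝ) + 1) * θ = k * θ := by
          push_cast; ring
        rw [hkθ, sin_two_pi_sub] at h
        rw [hkθ'] at h'
        refine (mul_eq_zero.mp ?_).resolve_right hsin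
        rw [add_mul, h, h']; ring
      rw [h1, h2, h3, h4, h0]
      simp

/-- The form `2 B(eᵢ, ·)`, where `B(eᵢ, eⱼ) = -cos (π / M i j)`, on the space of the geometric
representation. -/
noncomputable def CoxeterMatrix.simpleCoroot (M : CoxeterMatrix B) (i : B) :
    Module.Dual ℝ (B →₀ ℝ) :=
  Finsupp.linearCombination ℝ fun j ↦ -(2 * Real.cos (Real.pi / M i j))

theorem CoxeterMatrix.simpleCoroot_single (M : CoxeterMatrix B) (i j : B) :
    M.simpleCoroot i (Finsupp.single j 1) = -(2 * Real.cos (Real.pi / M i j)) := by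
  simp [CoxeterMatrix.simpleCoroot]

theorem CoxeterMatrix.simpleCoroot_single_self (M : CoxeterMatrix B) (i : B) :
    M.simpleCoroot i (Finsupp.single i 1) = 2 := by
  simp [CoxeterMatrix.simpleCoroot_single]

theorem CoxeterMatrix.isLiftable_reflection (M : CoxeterMatrix B) :
    M.IsLiftable fun i ↦ Module.reflection (M.simpleCoroot_single_self i) := by
  intro i j
  rcases eq_or_ne i j with rfl | hij
  · rw [M.diagonal, pow_one]
    ext1 v
    exact Module.involutive_reflection (M.simpleCoroot_single_self i) v
  · rcases Nat.eq_zero_or_pos (M i j) with h0 | hpos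
    · rw [h0, pow_zero]
    · have h1 := M.off_diagonal i j hij
      refine Module.reflection_mul_reflection_pow_eq_one_of_cos _ _ (by omega)
        (M.simpleCoroot_single i j) ?_
      rw [M.simpleCoroot_single, M.symmetric]

namespace CoxeterSystem

open CoxeterMatrix

/-- The geometric representation. -/
noncomputable def geomRep (cs : CoxeterSystem M W) : W →* ((B →₀ ℝ) ≃ₗ[ℝ] (B →₀ ℝ)) :=
  cs.lift ⟨_, M.isLiftable_reflection⟩

theorem geomRep_simple_apply (cs : CoxeterSystem M W) (i : B) (v : B →₀ ℝ) :
    cs.geomRep (cs.simple i) v = v - M.simpleCoroot i v • Finsupp.single i 1 := by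
  rw [geomRep, lift_apply_simple, Module.reflection_apply]

theorem simple_mem_parabolic (cs : CoxeterSystem M W) {J : Set B} {i : B} (hi : i ∈ J) :
    cs.simple i ∈ cs.parabolic J :=
  Subgroup.subset_closure ⟨i, hi, rfl⟩

theorem geomRep_apply_of_mem_parabolic (cs : CoxeterSystem M W) {J : Set B} {i : B} (hi : i ∉ J)
    {w : W} (hw : w ∈ cs.parabolic J) (v : B →₀ ℝ) : cs.geomRep w v i = v i := by
  induction hw using Subgroup.closure_induction generalizing v with
  | mem x hx =>
    obtain ⟨j, hj, rfl⟩ := hx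
    have hji : j ≠ i := fun h ↦ hi (h ▸ hj)
    simp [geomRep_simple_apply, hji]
  | one => simp
  | mul x y _ _ hx hy => rw [map_mul, LinearEquiv.mul_apply, hx, hy]
  | inv x _ hx =>
    rw [← hx, ← LinearEquiv.mul_apply, ← map_mul, mul_inv_cancel, map_one]
    rfl

theorem simple_notMem_parabolic (cs : CoxeterSystem M W) {J : Set B} {i : B} (hi : i ∉ J) :
    cs.simple i ∉ cs.parabolic J := by
  intro h
  have := cs.geomRep_apply_of_mem_parabolic hi h (Finsupp.single i 1)
  rw [geomRep_simple_apply, simpleCoroot_single_self] at this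
  norm_num at this

theorem commute_simple_of_conj_mem_parabolic (cs : CoxeterSystem M W) {J : Set B} {i j : B}
    (hi : i ∉ J) (hj : j ∈ J)
    (h : cs.simple i * cs.simple j * cs.simple i ∈ cs.parabolic J) :
    Commute (cs.simple i) (cs.simple j) := by
  have hji : j ≠ i := fun h ↦ hi (h ▸ hj)
  have hcoord := cs.geomRep_apply_of_mem_parabolic hi h (Finsupp.single i 1)
  simp only [map_mul, LinearEquiv.mul_apply, geomRep_simple_apply, simpleCoroot_single_self,
    simpleCoroot_single, map_sub, map_smul, Finsupp.sub_apply, Finsupp.smul_apply,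
    Finsupp.single_eq_same, Finsupp.single_eq_of_ne hji.symm, smul_eq_mul] at hcoord
  rw [M.symmetric j i] at hcoord
  have hcos : Real.cos (Real.pi / M i j) = 0 := by
    have : Real.cos (Real.pi / M i j) ^ 2 = 0 := by linarith
    exact pow_eq_zero_iff two_ne_zero |>.mp this
  have h1 := M.off_diagonal i j hji.symm
  have hM : M i j = 2 := by
    by_contra h2
    rcases Nat.eq_zero_or_pos (M i j) with h0 | hpos
    · simp [h0] at hcos
    · have h3 : (3 : ℝ) ≤ M i j := by exact_mod_cast (by omega : 3 ≤ M i j)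
      have hπ := Real.pi_pos
      refine (Real.cos_pos_of_mem_Ioo ⟨?_, ?_⟩).ne' hcos
      · have : 0 < Real.pi / M i j := by positivity
        linarith
      · rw [div_lt_div_iff₀ (by linarith) two_pos]
        nlinarith
  have hpow := cs.simple_mul_simple_pow i j
  rw [hM, pow_two] at hpow
  have := eq_inv_of_mul_eq_one_left hpow
  rwa [mul_inv_rev, inv_simple, inv_simple] at this

open scoped Classical in
/-- The action of `sᵢ` on signed group elements: conjugation, with a change of sign at `sᵢ`. -/
noncomputable def signedConj (cs : CoxeterSystem M W) (i : B) : Function.End (W × ZMod 2) :=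
  fun p ↦ (cs.simple i * p.1 * cs.simple i, p.2 + if cs.simple i = p.1 then 1 else 0)

open scoped Classical in
theorem prod_map_signedConj_apply (cs : CoxeterSystem M W) (ω : List B) (p : W × ZMod 2) :
    (ω.map cs.signedConj).prod p =
      (cs.wordProd ω * p.1 * (cs.wordProd ω)⁻¹, p.2 + (cs.rightInvSeq ω).count p.1) := by
  induction ω with
  | nil =>
    change p = _
    simp
  | cons i ω ih =>
    rw [List.map_cons, List.prod_cons]
    change cs.signedConj i ((ω.map cs.signedConj).prod p) = _
    have hiff : cs.simple i = cs.wordProd ω * p.1 * (cs.wordProd ω)⁻¹ ↔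
        (cs.wordProd ω)⁻¹ * cs.simple i * cs.wordProd ω = p.1 := by
      constructor
      · intro h; rw [h]; group
      · intro h; rw [← h]; group
    rw [ih, signedConj]
    simp only [hiff, rightInvSeq, List.count_cons, wordProd_cons, mul_inv_rev, inv_simple]
    simp only [mul_assoc, Nat.cast_add, Nat.cast_ite, Nat.cast_one, Nat.cast_zero, add_assoc, beq_iff_eq]

open scoped Classical in
theorem even_count_leftInvSeq_alternatingWord (cs : CoxeterSystem M W) (i j : B) (t : W) :
    Even ((cs.leftInvSeq (alternatingWord i j (2 * M i j))).count t) := by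
  set l := cs.leftInvSeq (alternatingWord i j (2 * M i j)) with hl
  have hlen : l.length = 2 * M i j := by simp [hl]
  have hper : l.drop (M i j) = l.take (M i j) := by
    apply List.ext_getElem
    · simp only [List.length_drop, List.length_take]; omega
    · intro k h₁ h₂
      simp only [List.length_take] at h₂
      rw [List.getElem_drop, List.getElem_take]
      simp only [hl]
      rw [getElem_leftInvSeq_alternatingWord _ _ _ _ _ (by omega),
        getElem_leftInvSeq_alternatingWord _ _ _ _ _ (by omega),
        prod_alternatingWord_eq_mul_pow, prod_alternatingWord_eq_mul_pow,
        show (2 * (M i j + k) + 1) / 2 = M i j + k by omega,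
        show (2 * k + 1) / 2 = k by omega, pow_add, simple_mul_simple_pow', one_mul,
        if_neg (by simp), if_neg (by simp)]
  rw [← List.take_append_drop (M i j) l, List.count_append, hper]
  exact ⟨_, rfl⟩

theorem prod_map_alternatingWord {G : Type*} [Monoid G] (f : B → G) (i j : B) (m : ℕ) :
    ((alternatingWord i j (2 * m)).map f).prod = (f i * f j) ^ m := by
  induction m with
  | zero => simp [alternatingWord]
  | succ m ih =>
    rw [show 2 * (m + 1) = 2 * m + 1 + 1 by ring, alternatingWord_succ', alternatingWord_succ',
      pow_succ']
    simp [ih, mul_assoc, parity_simps]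

theorem reverse_alternatingWord (i j : B) (m : ℕ) :
    (alternatingWord i j (2 * m)).reverse = alternatingWord j i (2 * m) := by
  induction m with
  | zero => simp [alternatingWord]
  | succ m ih =>
    rw [show 2 * (m + 1) = 2 * m + 1 + 1 by ring, alternatingWord_succ, alternatingWord_succ,
      alternatingWord_succ', alternatingWord_succ']
    simp [ih, parity_simps]

theorem isLiftable_signedConj (cs : CoxeterSystem M W) : M.IsLiftable cs.signedConj := by
  classical
  intro i j
  have hword : cs.wordProd (alternatingWord i j (2 * M i j)) = 1 := by
    rw [wordProd, prod_map_alternatingWord, simple_mul_simple_pow]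
  rw [← prod_map_alternatingWord]
  funext p
  have heven := cs.even_count_leftInvSeq_alternatingWord j i p.1
  rw [M.symmetric, ← reverse_alternatingWord, leftInvSeq_reverse, List.count_reverse] at heven
  rw [prod_map_signedConj_apply, hword, heven.natCast_zmod_two]
  change _ = p
  simp

open scoped Classical in
theorem natCast_count_rightInvSeq_eq (cs : CoxeterSystem M W) {ω ω' : List B}
    (h : cs.wordProd ω = cs.wordProd ω') (t : W) :
    ((cs.rightInvSeq ω).count t : ZMod 2) = (cs.rightInvSeq ω').count t := by
  have key (ω : List B) : cs.lift ⟨_, cs.isLiftable_signedConj⟩ (cs.wordProd ω) =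
      (ω.map cs.signedConj).prod := by
    rw [wordProd, map_list_prod, List.map_map]
    congr 2
    funext i
    exact cs.lift_apply_simple _ i
  have h' := congrFun (((key ω).symm.trans (congrArg _ h)).trans (key ω')) (t, 0)
  rw [prod_map_signedConj_apply, prod_map_signedConj_apply] at h'
  simpa using congrArg Prod.snd h'

theorem simple_mem_rightInvSeq_of_isRightDescent (cs : CoxeterSystem M W) {ω : List B} {i : B}
    (h : cs.IsRightDescent (cs.wordProd ω) i) : cs.simple i ∈ cs.rightInvSeq ω := by
  classical
  by_contra hmem
  obtain ⟨ω', hred, hω'⟩ := cs.exists_isReduced (cs.wordProd ω * cs.simple i)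
  have hω : cs.wordProd ω = cs.wordProd (ω'.concat i) := by
    rw [wordProd_concat, ← hω', simple_mul_simple_cancel_right]
  have hcount := cs.natCast_count_rightInvSeq_eq hω (cs.simple i)
  have hfix : MulAut.conj (cs.simple i) (cs.simple i) = cs.simple i := by simp
  have hmap : ((cs.rightInvSeq ω').map (MulAut.conj (cs.simple i))).count (cs.simple i) =
      (cs.rightInvSeq ω').count (cs.simple i) := by
    have := List.count_map_of_injective (cs.rightInvSeq ω') _
      (MulAut.conj (cs.simple i)).injective (cs.simple i)
    rwa [hfix] at this
  rw [List.count_eq_zero.mpr hmem, rightInvSeq_concat, List.concat_eq_append, List.count_append,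
    hmap, List.count_singleton_self] at hcount
  have hmem' : cs.simple i ∈ cs.rightInvSeq ω' := by
    by_contra h0
    rw [List.count_eq_zero.mpr h0] at hcount
    simp at hcount
  have hlt := (cs.isRightInversion_of_mem_rightInvSeq hred hmem').2
  rw [← hω', simple_mul_simple_cancel_right] at hlt
  exact lt_asymm h hlt

/-- The exchange property. -/
theorem exists_simple_mul_wordProd_eq_eraseIdx (cs : CoxeterSystem M W) {ω : List B} {i : B}
    (h : cs.IsLeftDescent (cs.wordProd ω) i) :
    ∃ k < ω.length, cs.simple i * cs.wordProd ω = cs.wordProd (ω.eraseIdx k) := by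
  have hmem : cs.simple i ∈ cs.leftInvSeq ω := by
    rw [← isRightDescent_inv_iff, ← wordProd_reverse] at h
    simpa [rightInvSeq_reverse] using cs.simple_mem_rightInvSeq_of_isRightDescent h
  obtain ⟨k, hk, hki⟩ := List.getElem_of_mem hmem
  refine ⟨k, by simpa using hk, ?_⟩
  rw [← getD_leftInvSeq_mul_wordProd, List.getD_eq_getElem _ _ hk, hki]

theorem wordProd_mem_parabolic (cs : CoxeterSystem M W) {J : Set B} {ω : List B}
    (hω : ∀ i ∈ ω, i ∈ J) : cs.wordProd ω ∈ cs.parabolic J := by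
  refine Subgroup.list_prod_mem _ fun x hx ↦ ?_
  obtain ⟨i, hi, rfl⟩ := List.mem_map.mp hx
  exact cs.simple_mem_parabolic (hω i hi)

theorem exists_word_of_mem_parabolic (cs : CoxeterSystem M W) {J : Set B} {w : W}
    (hw : w ∈ cs.parabolic J) : ∃ ω : List B, (∀ i ∈ ω, i ∈ J) ∧ cs.wordProd ω = w := by
  induction hw using Subgroup.closure_induction with
  | mem x hx =>
    obtain ⟨i, hi, rfl⟩ := hx
    exact ⟨[i], by simpa using hi, by simp⟩
  | one => exact ⟨[], by simp, by simp⟩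
  | mul x y _ _ hx hy =>
    obtain ⟨ω, hω, rfl⟩ := hx
    obtain ⟨ω', hω', rfl⟩ := hy
    refine ⟨ω ++ ω', fun i hi ↦ ?_, cs.wordProd_append ω ω'⟩
    exact (List.mem_append.mp hi).elim (hω i) (hω' i)
  | inv x _ hx =>
    obtain ⟨ω, hω, rfl⟩ := hx
    exact ⟨ω.reverse, by simpa using hω, cs.wordProd_reverse ω⟩

theorem not_isLeftDescent_of_mem_parabolic (cs : CoxeterSystem M W) {J : Set B} {i : B}
    (hi : i ∉ J) {w : W} (hw : w ∈ cs.parabolic J) : ¬ cs.IsLeftDescent w i := by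
  intro h
  obtain ⟨ω, hω, rfl⟩ := cs.exists_word_of_mem_parabolic hw
  obtain ⟨k, -, hk⟩ := cs.exists_simple_mul_wordProd_eq_eraseIdx h
  refine cs.simple_notMem_parabolic hi ((Subgroup.mul_mem_cancel_right _ hw).mp (hk ▸ ?_))
  exact cs.wordProd_mem_parabolic fun j hj ↦ hω j (List.mem_of_mem_eraseIdx hj)

theorem commute_of_isLeftDescent_simple_mul (cs : CoxeterSystem M W) {J : Set B} {i j : B}
    (hi : i ∉ J) (hj : j ∈ J) {u : W} (hu : u ∈ cs.parabolic J)
    (h : cs.IsLeftDescent (cs.simple i * u) j) : Commute (cs.simple i) (cs.simple j) := by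
  have hsj := cs.simple_mem_parabolic hj
  obtain ⟨ω, hω, hωu⟩ := cs.exists_word_of_mem_parabolic (mul_mem hsj hu)
  have hword : cs.simple i * u = cs.wordProd (i :: j :: ω) := by
    rw [wordProd_cons, wordProd_cons, hωu, simple_mul_simple_cancel_left]
  rw [hword] at h
  obtain ⟨k, -, hk⟩ := cs.exists_simple_mul_wordProd_eq_eraseIdx h
  rw [← hword] at hk
  rcases k with _ | k
  · rw [List.eraseIdx_cons_zero, wordProd_cons, hωu, simple_mul_simple_cancel_left,
      ← mul_assoc, mul_eq_right] at hk
    refine absurd ?_ (cs.simple_notMem_parabolic hi)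
    rw [← inv_eq_of_mul_eq_one_right hk, inv_simple]
    exact hsj
  · rw [List.eraseIdx_cons_succ, wordProd_cons] at hk
    have hmem : cs.wordProd ((j :: ω).eraseIdx k) ∈ cs.parabolic J :=
      cs.wordProd_mem_parabolic fun l hl ↦ by
        rcases List.mem_cons.mp (List.mem_of_mem_eraseIdx hl) with rfl | hl
        exacts [hj, hω l hl]
    refine cs.commute_simple_of_conj_mem_parabolic hi hj ?_
    rw [← Subgroup.mul_mem_cancel_right _ hu]
    rwa [mul_assoc, mul_assoc, hk, simple_mul_simple_cancel_left]

end CoxeterSystem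

theorem length_and_descents_of_w0J_mul_noncommuting_simple
    (cs : CoxeterSystem M W) (J : Set B)
    (hfin : Finite (cs.parabolic J))
    (w0J : W) (hw0J : w0J ∈ cs.parabolic J)
    (hw0Jmax : ∀ u ∈ cs.parabolic J, cs.length u ≤ cs.length w0J)
    (α : B) (hα : α ∉ J)
    (β : B) (hβ : β ∈ J)
    (hnc : cs.simple α * cs.simple β ≠ cs.simple β * cs.simple α) :
    cs.length (w0J * cs.simple α) = cs.length w0J + 1 ∧
    {i : B | cs.IsLeftDescent (w0J * cs.simple α) i} = J := by
  have hsα (u : W) (hu : u ∈ cs.parabolic J) : cs.length (u * cs.simple α) = cs.length u + 1 := by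
    rw [← cs.not_isRightDescent_iff, ← cs.isLeftDescent_inv_iff]
    exact cs.not_isLeftDescent_of_mem_parabolic hα (inv_mem hu)
  have hJ (j : B) (hj : j ∈ J) : cs.IsLeftDescent (w0J * cs.simple α) j := by
    have hmem := mul_mem (cs.simple_mem_parabolic hj) hw0J
    rw [CoxeterSystem.IsLeftDescent, ← mul_assoc, hsα _ hmem, hsα _ hw0J]
    have := hw0Jmax _ hmem
    have := cs.length_simple_mul_ne w0J j
    omega
  refine ⟨hsα w0J hw0J, Set.Subset.antisymm (fun i hi ↦ ?_) hJ⟩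
  by_contra hiJ
  obtain ⟨ω, hω, hωw⟩ := cs.exists_word_of_mem_parabolic hw0J
  have hword : w0J * cs.simple α = cs.wordProd (ω ++ [α]) := by
    rw [cs.wordProd_append, hωw, cs.wordProd_singleton]
  have hi' : cs.IsLeftDescent (cs.wordProd (ω ++ [α])) i := hword ▸ hi
  obtain ⟨k, hk, hki⟩ := cs.exists_simple_mul_wordProd_eq_eraseIdx hi'
  rw [← hword] at hki
  rcases lt_or_ge k ω.length with hlt | hge
  · rw [List.eraseIdx_append_of_lt_length hlt, cs.wordProd_append, cs.wordProd_singleton,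
      ← mul_assoc] at hki
    refine cs.simple_notMem_parabolic hiJ ((Subgroup.mul_mem_cancel_right _ hw0J).mp ?_)
    rw [mul_right_cancel hki]
    exact cs.wordProd_mem_parabolic fun j hj ↦ hω j (List.mem_of_mem_eraseIdx hj)
  · have hkω : k - ω.length = 0 := by simp at hk; omega
    rw [List.eraseIdx_append_of_length_le hge, hkω, List.eraseIdx_cons_zero, List.append_nil,
      hωw] at hki
    have heq : w0J * cs.simple α = cs.simple i * w0J := by
      rw [← cs.simple_mul_simple_cancel_left (w := w0J * cs.simple α) i, hki]
    have hcomm (j : B) (hj : j ∈ J) : Commute (cs.simple i) (cs.simple j) :=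
      cs.commute_of_isLeftDescent_simple_mul hiJ hj hw0J (heq ▸ hJ j hj)
    have hcw : Commute (cs.simple i) w0J := by
      have hle : cs.parabolic J ≤ Subgroup.centralizer {cs.simple i} := by
        rw [CoxeterSystem.parabolic, Subgroup.closure_le]
        rintro _ ⟨j, hj, rfl⟩
        exact Subgroup.mem_centralizer_singleton_iff.mpr (hcomm j hj).symm
      exact (Subgroup.mem_centralizer_singleton_iff.mp (hle hw0J)).symm
    have hαi : cs.simple α = cs.simple i := mul_left_cancel (heq.trans hcw.eq)
    exact hnc (hαi ▸ hcomm β hβ)
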